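/- arXiv:2401.04847 — 2 statements merged into one kernel-verified Lean document; each statement's English description precedes it below -/
import Mathlib

section
/- Let b ∈ Cf_g(X). Suppose the pair (L*, U*), where U* is an upper set of X, L* is a lower set of X, and L* ∩ U* = ∅, maximizes the quantity min Σ_b(U) − max Σ_b(L) over all pairs (L, U) of a lower set L and an upper set U with L ∩ U = ∅. Then L* is a minimal lower set of X with respect to b and U* is a maximal upper set of X with respect to b. -/
open Pointwise Finset
open scoped Classical

variable {X : Type*}

/-- `f` is isotonic on the subset `S` of `X`. -/
def IsotonicOn [PartialOrder X] (f : X → ℝ) (S : Finset X) : Prop :=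
  ∀ x ∈ S, ∀ y ∈ S, x ≤ y → f x ≤ f y

/-- The separable loss `J_S(g, f) = Σ_{x∈S} ℓ(g(x), f(x))`. -/
noncomputable def lossJ (ℓ : ℝ → ℝ → ℝ) (g : X → ℝ) (S : Finset X) (f : X → ℝ) : ℝ :=
  ∑ x ∈ S, ℓ (g x) (f x)

/-- The subdifferential of the convex function `ℓ(a, ·)` at `b`. -/
def subdiff (ℓ : ℝ → ℝ → ℝ) (a b : ℝ) : Set ℝ :=
  {s : ℝ | ∀ y : ℝ, ℓ a b + s * (y - b) ≤ ℓ a y}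

/-- `Σ_b(S) = −Σ_{x∈S} ∂ℓ(g(x), b)` (Minkowski sum; `Σ_b(∅) = {0}`). -/
noncomputable def SigmaSet (ℓ : ℝ → ℝ → ℝ) (g : X → ℝ) (b : ℝ) (S : Finset X) : Set ℝ :=
  -∑ x ∈ S, subdiff ℓ (g x) b

/-- `U` is an upper set of `X`. -/
def IsUpperFinset [PartialOrder X] (U : Finset X) : Prop :=
  ∀ x ∈ U, ∀ y : X, x ≤ y → y ∈ U

/-- `L` is a lower set of `X`. -/
def IsLowerFinset [PartialOrder X] (L : Finset X) : Prop :=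
  ∀ y ∈ L, ∀ x : X, x ≤ y → x ∈ L

/-- `U` is a maximal upper set with respect to `b`:
it maximizes `min Σ_b(U')` over all upper sets `U'`. -/
def IsMaxUpper [PartialOrder X] (ℓ : ℝ → ℝ → ℝ) (g : X → ℝ) (b : ℝ) (U : Finset X) : Prop :=
  IsUpperFinset U ∧ ∀ U' : Finset X, IsUpperFinset U' →
    sInf (SigmaSet ℓ g b U') ≤ sInf (SigmaSet ℓ g b U)

/-- `L` is a minimal lower set with respect to `b`:
it minimizes `max Σ_b(L')` over all lower sets `L'`. -/
def IsMinLower [PartialOrder X] (ℓ : ℝ → ℝ → ℝ) (g : X → ℝ) (b : ℝ) (L : Finset X) : Prop :=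
  IsLowerFinset L ∧ ∀ L' : Finset X, IsLowerFinset L' →
    sSup (SigmaSet ℓ g b L) ≤ sSup (SigmaSet ℓ g b L')

/-- A convex function on the line has a subgradient at every point. -/
theorem subdiff_nonempty {ℓ : ℝ → ℝ → ℝ} {a : ℝ} (h : ConvexOn ℝ Set.univ (ℓ a)) (b : ℝ) :
    (subdiff ℓ a b).Nonempty := by
  refine ⟨derivWithin (ℓ a) (Set.Ioi b) b, fun y => ?_⟩
  have hb : b ∈ interior (Set.univ : Set ℝ) := by simp
  rcases lt_trichotomy y b with hy | rfl | hy
  · have hs := (h.slope_le_leftDeriv_of_mem_interior (Set.mem_univ y) hb hy).trans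
      (h.leftDeriv_le_rightDeriv_of_mem_interior hb)
    rw [slope_def_field, div_le_iff₀ (sub_pos.2 hy)] at hs
    linarith
  · simp
  · have hs := h.rightDeriv_le_slope_of_mem_interior hb (Set.mem_univ y) hy
    rw [slope_def_field, le_div_iff₀ (sub_pos.2 hy)] at hs
    linarith

theorem bddAbove_subdiff (ℓ : ℝ → ℝ → ℝ) (a b : ℝ) : BddAbove (subdiff ℓ a b) := by
  refine ⟨ℓ a (b + 1) - ℓ a b, fun s hs => ?_⟩
  have := hs (b + 1)
  linarith

theorem bddBelow_subdiff (ℓ : ℝ → ℝ → ℝ) (a b : ℝ) : BddBelow (subdiff ℓ a b) := by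
  refine ⟨ℓ a b - ℓ a (b - 1), fun s hs => ?_⟩
  have := hs (b - 1)
  linarith

theorem sigmaSet_nonempty {ℓ : ℝ → ℝ → ℝ} (h : ∀ a, ConvexOn ℝ Set.univ (ℓ a))
    (g : X → ℝ) (b : ℝ) (S : Finset X) : (SigmaSet ℓ g b S).Nonempty := by
  refine Set.Nonempty.neg ?_
  induction S using Finset.induction_on with
  | empty => simp
  | insert x S hx ih =>
    rw [Finset.sum_insert hx]
    exact (subdiff_nonempty (h _) b).add ih

theorem bddBelow_sigmaSet (ℓ : ℝ → ℝ → ℝ) (g : X → ℝ) (b : ℝ) (S : Finset X) :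
    BddBelow (SigmaSet ℓ g b S) := by
  refine BddAbove.neg ?_
  induction S using Finset.induction_on with
  | empty => simp [← Set.singleton_zero]
  | insert x S hx ih =>
    rw [Finset.sum_insert hx]
    exact (bddAbove_subdiff ℓ _ b).add ih

theorem bddAbove_sigmaSet (ℓ : ℝ → ℝ → ℝ) (g : X → ℝ) (b : ℝ) (S : Finset X) :
    BddAbove (SigmaSet ℓ g b S) := by
  refine BddBelow.neg ?_
  induction S using Finset.induction_on with
  | empty => simp [← Set.singleton_zero]
  | insert x S hx ih =>
    rw [Finset.sum_insert hx]
    exact (bddBelow_subdiff ℓ _ b).add ih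

theorem sigmaSet_sdiff_add_inter (ℓ : ℝ → ℝ → ℝ) (g : X → ℝ) (b : ℝ) (S T : Finset X) :
    SigmaSet ℓ g b (S \ T) + SigmaSet ℓ g b (S ∩ T) = SigmaSet ℓ g b S := by
  unfold SigmaSet
  rw [← Finset.sum_inter_add_sum_sdiff S T, neg_add, add_comm]

theorem sInf_sigmaSet_sdiff {ℓ : ℝ → ℝ → ℝ} (h : ∀ a, ConvexOn ℝ Set.univ (ℓ a))
    (g : X → ℝ) (b : ℝ) (S T : Finset X) :
    sInf (SigmaSet ℓ g b (S \ T)) + sInf (SigmaSet ℓ g b (S ∩ T)) =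
      sInf (SigmaSet ℓ g b S) := by
  rw [← sigmaSet_sdiff_add_inter ℓ g b S T,
    csInf_add (sigmaSet_nonempty h g b _) (bddBelow_sigmaSet ℓ g b _)
      (sigmaSet_nonempty h g b _) (bddBelow_sigmaSet ℓ g b _)]

theorem sSup_sigmaSet_sdiff {ℓ : ℝ → ℝ → ℝ} (h : ∀ a, ConvexOn ℝ Set.univ (ℓ a))
    (g : X → ℝ) (b : ℝ) (S T : Finset X) :
    sSup (SigmaSet ℓ g b (S \ T)) + sSup (SigmaSet ℓ g b (S ∩ T)) =
      sSup (SigmaSet ℓ g b S) := by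
  rw [← sigmaSet_sdiff_add_inter ℓ g b S T,
    csSup_add (sigmaSet_nonempty h g b _) (bddAbove_sigmaSet ℓ g b _)
      (sigmaSet_nonempty h g b _) (bddAbove_sigmaSet ℓ g b _)]

theorem IsLowerFinset.sdiff [PartialOrder X] {L U : Finset X} (hL : IsLowerFinset L)
    (hU : IsUpperFinset U) : IsLowerFinset (L \ U) := by
  intro y hy x hxy
  rw [Finset.mem_sdiff] at hy ⊢
  exact ⟨hL y hy.1 x hxy, fun hx => hy.2 (hU x hx y hxy)⟩

theorem IsUpperFinset.sdiff [PartialOrder X] {U L : Finset X} (hU : IsUpperFinset U)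
    (hL : IsLowerFinset L) : IsUpperFinset (U \ L) := by
  intro x hx y hxy
  rw [Finset.mem_sdiff] at hx ⊢
  exact ⟨hU x hx.1 y hxy, fun hy => hx.2 (hL y hy x hxy)⟩

/-- Removing the overlap of a pair of sets from both does not decrease `min Σ_b(U) − max Σ_b(L)`. -/
theorem sInf_sub_sSup_sigmaSet_le_sdiff {ℓ : ℝ → ℝ → ℝ}
    (h : ∀ a, ConvexOn ℝ Set.univ (ℓ a)) (g : X → ℝ) (b : ℝ) (L U : Finset X) :
    sInf (SigmaSet ℓ g b U) - sSup (SigmaSet ℓ g b L) ≤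
      sInf (SigmaSet ℓ g b (U \ L)) - sSup (SigmaSet ℓ g b (L \ U)) := by
  have hU := sInf_sigmaSet_sdiff h g b U L
  have hL := sSup_sigmaSet_sdiff h g b L U
  have hle := csInf_le_csSup (sigmaSet_nonempty h g b (L ∩ U))
    (bddBelow_sigmaSet ℓ g b _) (bddAbove_sigmaSet ℓ g b _)
  rw [Finset.inter_comm U L] at hU
  linarith

/-- If the disjoint lower/upper pair `(L*, U*)` maximizes
`min Σ_b(U) − max Σ_b(L)` over all disjoint pairs of a lower set `L` and an upper
set `U`, where `b ∈ Cf_g(X)`, then `L*` is a minimal lower set and `U*` is a maximal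
upper set w.r.t. `b`. -/
theorem joint_partition_gives_minimal_and_maximal
    [Fintype X] [Nonempty X] [PartialOrder X]
    (ℓ : ℝ → ℝ → ℝ) (hconv : ∀ a : ℝ, ConvexOn ℝ (Set.univ : Set ℝ) (ℓ a))
    (g : X → ℝ) (b : ℝ)
    (hb : ∀ y : ℝ, ∑ x : X, ℓ (g x) b ≤ ∑ x : X, ℓ (g x) y)
    (Lstar Ustar : Finset X)
    (hLstar : IsLowerFinset Lstar) (hUstar : IsUpperFinset Ustar)
    (hdisj : Disjoint Lstar Ustar)
    (hopt : ∀ L U : Finset X, IsLowerFinset L → IsUpperFinset U → Disjoint L U →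
      sInf (SigmaSet ℓ g b U) - sSup (SigmaSet ℓ g b L) ≤
        sInf (SigmaSet ℓ g b Ustar) - sSup (SigmaSet ℓ g b Lstar)) :
    IsMinLower ℓ g b Lstar ∧ IsMaxUpper ℓ g b Ustar := by
  have key : ∀ L U : Finset X, IsLowerFinset L → IsUpperFinset U →
      sInf (SigmaSet ℓ g b U) - sSup (SigmaSet ℓ g b L) ≤
        sInf (SigmaSet ℓ g b Ustar) - sSup (SigmaSet ℓ g b Lstar) := fun L U hL hU =>
    (sInf_sub_sSup_sigmaSet_le_sdiff hconv g b L U).trans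
      (hopt _ _ (hL.sdiff hU) (hU.sdiff hL) (disjoint_sdiff_sdiff))
  refine ⟨⟨hLstar, fun L hL => ?_⟩, ⟨hUstar, fun U hU => ?_⟩⟩
  · linarith [key L Ustar hL hUstar]
  · linarith [key Lstar U hLstar hU]
end

section
/- Let b ∈ ℝ and let U be a nonempty maximal upper set of X with respect to b. Suppose b_U ∈ ℝ satisfies b_U ≤ b and the constant function x ↦ b_U minimizes J_U(g, ·) over I_U. Then the constant function x ↦ b also minimizes J_U(g, ·) over I_U; in particular, b ∈ Cf_g(U). -/
open Pointwise Finset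
open scoped Classical

variable {X : Type*}

theorem isGreatest_subdiff_rightDeriv {ℓ : ℝ → ℝ → ℝ} {a : ℝ}
    (hconv : ConvexOn ℝ Set.univ (ℓ a)) (b : ℝ) :
    IsGreatest (subdiff ℓ a b) (derivWithin (ℓ a) (Set.Ioi b) b) := by
  have hint : ∀ x : ℝ, x ∈ interior (Set.univ : Set ℝ) := by simp
  constructor
  · intro y
    rcases lt_trichotomy b y with hy | rfl | hy
    · have h := hconv.rightDeriv_le_slope_of_mem_interior (hint b) (Set.mem_univ y) hy
      rw [slope_def_field, le_div_iff₀ (sub_pos.2 hy)] at h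
      linarith
    · simp
    · have h := (hconv.slope_le_leftDeriv_of_mem_interior (Set.mem_univ y) (hint b) hy).trans
        (hconv.leftDeriv_le_rightDeriv_of_mem_interior (hint b))
      rw [slope_def_field, div_le_iff₀ (sub_pos.2 hy)] at h
      linarith
  · intro s hs
    rw [hconv.rightDeriv_eq_sInf_slope_of_mem_interior (hint b)]
    refine le_csInf (Set.Nonempty.image _ ⟨b + 1, Set.mem_univ _, by simp⟩) ?_
    rintro _ ⟨y, ⟨-, hy⟩, rfl⟩
    rw [slope_def_field, le_div_iff₀ (sub_pos.2 hy)]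
    linarith [hs y]

theorem isGreatest_finset_sum {ι : Type*} {A : ι → Set ℝ} {r : ι → ℝ} (S : Finset ι)
    (h : ∀ x ∈ S, IsGreatest (A x) (r x)) : IsGreatest (∑ x ∈ S, A x) (∑ x ∈ S, r x) := by
  induction S using Finset.induction_on with
  | empty => exact isGreatest_singleton
  | insert i S hi ih =>
    rw [sum_insert hi, sum_insert hi]
    have h₁ := h i (mem_insert_self i S)
    have h₂ := ih fun x hx => h x (mem_insert_of_mem hx)
    refine ⟨Set.add_mem_add h₁.1 h₂.1, ?_⟩
    rintro _ ⟨u, hu, v, hv, rfl⟩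
    exact add_le_add (h₁.2 hu) (h₂.2 hv)

theorem sInf_sigmaSet {ℓ : ℝ → ℝ → ℝ} (hconv : ∀ a : ℝ, ConvexOn ℝ Set.univ (ℓ a))
    (g : X → ℝ) (b : ℝ) (S : Finset X) :
    sInf (SigmaSet ℓ g b S) = -∑ x ∈ S, derivWithin (ℓ (g x)) (Set.Ioi b) b := by
  have h := isGreatest_finset_sum S fun x _ => isGreatest_subdiff_rightDeriv (hconv (g x)) b
  rw [SigmaSet, Real.sInf_neg, h.csSup_eq]

/-- Layer-cake inequality: nonnegative weights on all superlevel sets of `f ≥ 0` give a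
nonnegative weighted sum of `f`. -/
theorem sum_mul_nonneg_of_superlevel (S : Finset X) (r f : X → ℝ) (hf : ∀ x ∈ S, 0 ≤ f x)
    (hr : ∀ t : ℝ, 0 ≤ ∑ x ∈ S with t < f x, r x) : 0 ≤ ∑ x ∈ S, r x * f x := by
  induction S using Finset.strongInduction generalizing f with
  | H S ih =>
    rcases S.eq_empty_or_nonempty with rfl | hS
    · simp
    obtain ⟨m, hm, hmin⟩ := S.exists_min_image f hS
    have hlt : ({x ∈ S | f m < f x}) ⊂ S := filter_ssubset.2 ⟨m, hm, lt_irrefl _⟩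
    have hV := ih _ hlt (fun x => f x - f m)
      (fun x hx => by linarith [(mem_filter.1 hx).2]) fun t => by
        rw [filter_filter]
        convert hr (max (f m) (f m + t)) using 3
        rw [max_lt_iff, lt_sub_iff_add_lt']
    have hS0 : 0 ≤ ∑ x ∈ S, r x := by
      have h := hr (-1)
      rwa [filter_true_of_mem fun x hx => by linarith [hf x hx]] at h
    have hsum : ∑ x ∈ S with f m < f x, r x * (f x - f m) = ∑ x ∈ S, r x * (f x - f m) := by
      refine sum_filter_of_ne fun x hx hne => (hmin x hx).lt_of_ne fun h => hne ?_
      simp [h]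
    rw [hsum] at hV
    simp only [mul_sub, sum_sub_distrib, ← sum_mul] at hV
    linarith [mul_nonneg hS0 (hf m hm)]

/-- If `U` is a nonempty maximal upper set w.r.t. `b`, `b_U ≤ b`, and the
constant function `b_U` minimizes `J_U(g, ·)` over `I_U`, then the constant function `b`
also minimizes `J_U(g, ·)` over `I_U`; in particular `b ∈ Cf_g(U)`. -/
theorem larger_constant_still_minimizes_on_maximal_upper
    [Fintype X] [Nonempty X] [PartialOrder X]
    (ℓ : ℝ → ℝ → ℝ) (hconv : ∀ a : ℝ, ConvexOn ℝ (Set.univ : Set ℝ) (ℓ a))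
    (g : X → ℝ) (b bU : ℝ) (U : Finset X)
    (hmax : IsMaxUpper ℓ g b U) (hUne : U.Nonempty)
    (hle : bU ≤ b)
    (hbUmin : ∀ h : X → ℝ, IsotonicOn h U →
      lossJ ℓ g U (fun _ => bU) ≤ lossJ ℓ g U h) :
    (∀ h : X → ℝ, IsotonicOn h U →
      lossJ ℓ g U (fun _ => b) ≤ lossJ ℓ g U h) ∧
    (∀ y : ℝ, ∑ x ∈ U, ℓ (g x) b ≤ ∑ x ∈ U, ℓ (g x) y) := by
  set r : X → ℝ := fun x => derivWithin (ℓ (g x)) (Set.Ioi b) b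
  have hsub : ∀ x y, ℓ (g x) b + r x * (y - b) ≤ ℓ (g x) y := fun x =>
    (isGreatest_subdiff_rightDeriv (hconv (g x)) b).1
  have hmono : ∀ U' : Finset X, IsUpperFinset U' → ∑ x ∈ U, r x ≤ ∑ x ∈ U', r x := by
    intro U' hU'
    have h := hmax.2 U' hU'
    rw [sInf_sigmaSet hconv, sInf_sigmaSet hconv] at h
    exact neg_le_neg_iff.1 h
  have main : ∀ h : X → ℝ, IsotonicOn h U → lossJ ℓ g U (fun _ => b) ≤ lossJ ℓ g U h := by
    rcases hle.eq_or_lt with rfl | hlt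
    · exact hbUmin
    intro h hh
    have hU_nonpos : ∑ x ∈ U, r x ≤ 0 := by
      simpa using hmono ∅ (by simp [IsUpperFinset])
    have hU_nonneg : 0 ≤ ∑ x ∈ U, r x := by
      have h₁ := hbUmin (fun _ => b) fun _ _ _ _ _ => le_rfl
      have h₂ := sum_le_sum fun x (_ : x ∈ U) => hsub x bU
      rw [sum_add_distrib, ← sum_mul] at h₂
      simp only [lossJ] at h₁
      by_contra! hneg
      linarith [mul_pos_of_neg_of_neg hneg (sub_neg.2 hlt)]
    have hU : ∑ x ∈ U, r x = 0 := le_antisymm hU_nonpos hU_nonneg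
    obtain ⟨m, -, hmin⟩ := U.exists_min_image h hUne
    have hcake := sum_mul_nonneg_of_superlevel U r (fun x => h x - h m)
      (fun x hx => sub_nonneg.2 (hmin x hx)) fun t => by
        refine hU_nonneg.trans (hmono _ fun x hx y hxy => ?_)
        obtain ⟨hxU, hxt⟩ := mem_filter.1 hx
        have hyU := hmax.1 x hxU y hxy
        exact mem_filter.2 ⟨hyU, by linarith [hh x hxU y hyU hxy]⟩
    have h₂ := sum_le_sum fun x (_ : x ∈ U) => hsub x (h x)
    simp only [mul_sub, sum_add_distrib, sum_sub_distrib, ← sum_mul, hU] at hcake h₂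
    simp only [lossJ]
    linarith
  exact ⟨main, fun y => main (fun _ => y) fun _ _ _ _ _ => le_rfl⟩
end
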